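/- arXiv:1504.06838 — 2 statements merged into one kernel-verified Lean document; each statement's English description precedes it below -/
import Mathlib

section
/- Let Q be a logic (complete orthomodular lattice), let A be any subset of Q, let P1, P2 ∈ A, and let E ∈ A^! (i.e., E commutes with every element of A). Then (P1 ∧ E) commutes with (P2 ∧ E) if and only if (P1 ∧ E) commutes with P2. -/
/-- A *logic*: a complete orthomodular lattice. -/
class COL (Q : Type*) extends CompleteLattice Q where
  /-- orthocomplementation -/
  oc : Q → Q
  oc_antitone : ∀ {P R : Q}, P ≤ R → oc R ≤ oc P
  oc_oc : ∀ P : Q, oc (oc P) = P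
  sup_oc : ∀ P : Q, P ⊔ oc P = ⊤
  inf_oc : ∀ P : Q, P ⊓ oc P = ⊥
  orthomodular : ∀ {P R : Q}, P ≤ R → P ⊔ (oc P ⊓ R) = R

variable {Q : Type*} [COL Q]

/-- `P` commutes with `R`, written `P ∘ R` in the paper. -/
def COL.commutes (P R : Q) : Prop := P = (P ⊓ R) ⊔ (P ⊓ COL.oc R)

/-- The commutant `A^!` of a subset `A` of a logic. -/
def COL.commutant (A : Set Q) : Set Q := {P : Q | ∀ R ∈ A, COL.commutes P R}

namespace COL

theorem le_oc_of_le_oc {P R : Q} (h : P ≤ oc R) : R ≤ oc P := by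
  simpa only [oc_oc] using oc_antitone h

/-- If `E` commutes with `P`, the relative complement of `P ⊓ E` in `E` is `oc P ⊓ E`. -/
theorem inf_oc_inf_eq_of_commutes {E P : Q} (h : commutes E P) :
    E ⊓ oc (P ⊓ E) = E ⊓ oc P := by
  have hle : E ⊓ oc P ≤ E ⊓ oc (P ⊓ E) := inf_le_inf_left E (oc_antitone inf_le_left)
  have hbot : oc (E ⊓ oc P) ⊓ (E ⊓ oc (P ⊓ E)) = ⊥ := by
    set c := oc (E ⊓ oc P) ⊓ (E ⊓ oc (P ⊓ E))
    have hcE : c ≤ E := inf_le_right.trans inf_le_left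
    have hEc : E ≤ oc c := by
      rw [h]
      refine sup_le (le_oc_of_le_oc ?_) (le_oc_of_le_oc inf_le_left)
      rw [inf_comm E P]
      exact inf_le_right.trans inf_le_right
    rw [eq_bot_iff, ← inf_oc c]
    exact le_inf le_rfl (hcE.trans hEc)
  have hom := orthomodular hle
  rw [hbot, sup_bot_eq] at hom
  exact hom.symm

end COL

/-- Lemma 2.4: for `P1, P2 ∈ A` and `E ∈ A^!`, `(P1 ⊓ E)` commutes with `(P2 ⊓ E)`
iff `(P1 ⊓ E)` commutes with `P2`. -/
theorem stmt0 (A : Set Q) (P1 P2 E : Q) (h1 : P1 ∈ A) (h2 : P2 ∈ A)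
    (hE : E ∈ COL.commutant A) :
    COL.commutes (P1 ⊓ E) (P2 ⊓ E) ↔ COL.commutes (P1 ⊓ E) P2 := by
  have hinf : P1 ⊓ E ⊓ (P2 ⊓ E) = P1 ⊓ E ⊓ P2 := by
    rw [inf_comm P2 E, ← inf_assoc, inf_assoc P1 E E, inf_idem]
  have hoc : P1 ⊓ E ⊓ COL.oc (P2 ⊓ E) = P1 ⊓ E ⊓ COL.oc P2 := by
    rw [inf_assoc, COL.inf_oc_inf_eq_of_commutes (hE P2 h2), inf_assoc]
  unfold COL.commutes
  rw [hinf, hoc]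
end

section
/- Let Q be a logic and A ⊆ Q. Then ⋁S(A) is itself a subcommutator of A, i.e., ⋁S(A) ∈ S(A), so ⋁S(A) is the maximum subcommutator of A. -/
variable {Q : Type*} [COL Q]

/-- The sublogic `L(A) = A^!!` generated by `A`. -/
def COL.Lgen (A : Set Q) : Set Q := COL.commutant (COL.commutant A)

/-- The center `Z(A) = A^! ∩ A^!!` of the sublogic generated by `A`. -/
def COL.Zcen (A : Set Q) : Set Q := COL.commutant A ∩ COL.Lgen A

/-- The set `S(A)` of subcommutators of `A`. -/
def COL.subcom (A : Set Q) : Set Q :=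
  {E : Q | E ∈ COL.Zcen A ∧ ∀ P1 ∈ A, ∀ P2 ∈ A, COL.commutes (P1 ⊓ E) (P2 ⊓ E)}

/-- Takeuti's commutator `com(A)`. -/
def COL.com (A : Set Q) : Q :=
  sSup {E : Q | E ∈ COL.commutant A ∧ ∀ P1 ∈ A, ∀ P2 ∈ A, COL.commutes (P1 ⊓ E) (P2 ⊓ E)}

namespace COL

theorem le_oc_sup {P R T : Q} (h₁ : T ≤ oc P) (h₂ : T ≤ oc R) : T ≤ oc (P ⊔ R) :=
  le_oc_of_le_oc (sup_le (le_oc_of_le_oc h₁) (le_oc_of_le_oc h₂))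

theorem commutes_of_le {P R : Q} (h : P ≤ (P ⊓ R) ⊔ (P ⊓ oc R)) : commutes P R :=
  le_antisymm h (sup_le inf_le_left inf_le_left)

theorem commutes.oc_inf_inf_le {P R : Q} (h : commutes P R) : oc (P ⊓ R) ⊓ R ≤ oc P := by
  conv_rhs => rw [h]
  exact le_oc_sup inf_le_left (inf_le_right.trans (le_oc_of_le_oc inf_le_right))

theorem commutes.symm {P R : Q} (h : commutes P R) : commutes R P := by
  refine commutes_of_le ?_
  conv_lhs => rw [← orthomodular (inf_le_right : P ⊓ R ≤ R)]
  exact sup_le_sup (inf_comm P R).le (le_inf inf_le_right h.oc_inf_inf_le)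

theorem commutes_sSup {S : Set Q} {P : Q} (h : ∀ F ∈ S, commutes F P) :
    commutes (sSup S) P := by
  refine commutes_of_le (sSup_le fun F hF => ?_)
  rw [h F hF]
  exact sup_le_sup (inf_le_inf_right _ (le_sSup hF)) (inf_le_inf_right _ (le_sSup hF))

theorem sSup_mem_commutant {S A : Set Q} (h : S ⊆ commutant A) : sSup S ∈ commutant A :=
  fun P hP => commutes_sSup fun _ hF => h hF P hP

/-- An element distributes over the supremum of a set of elements commuting with it. -/
theorem inf_sSup_le {S : Set Q} {P : Q} (h : ∀ F ∈ S, commutes F P) :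
    P ⊓ sSup S ≤ ⨆ F ∈ S, F ⊓ P := by
  have hs : ⨆ F ∈ S, F ⊓ P ≤ P ⊓ sSup S :=
    iSup₂_le fun F hF => le_inf inf_le_right (inf_le_left.trans (le_sSup hF))
  rw [← orthomodular hs]
  refine sup_le le_rfl ?_
  set d := oc (⨆ F ∈ S, F ⊓ P) ⊓ (P ⊓ sSup S)
  have hd : sSup S ≤ oc d := sSup_le fun F hF => le_oc_of_le_oc <| le_trans
    (inf_le_inf (oc_antitone (le_iSup₂_of_le F hF le_rfl)) inf_le_left) (h F hF).oc_inf_inf_le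
  have hbot : d ≤ ⊥ := by
    rw [← inf_oc d]
    exact le_inf le_rfl ((inf_le_right.trans inf_le_right).trans hd)
  exact hbot.trans bot_le

end COL

/-- Theorem 2.5 (ii): `⋁ S(A)` is the maximum subcommutator of `A`, i.e. `⋁ S(A) ∈ S(A)`. -/
theorem stmt2 (A : Set Q) : sSup (COL.subcom A) ∈ COL.subcom A := by
  refine ⟨⟨COL.sSup_mem_commutant fun F hF => hF.1.1,
    COL.sSup_mem_commutant fun F hF => hF.1.2⟩, fun P₁ h₁ P₂ h₂ => COL.commutes_of_le ?_⟩
  refine (COL.inf_sSup_le fun F hF => hF.1.1 P₁ h₁).trans (iSup₂_le fun F hF => ?_)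
  have hle : F ≤ sSup (COL.subcom A) := le_sSup hF
  rw [inf_comm, hF.2 P₁ h₁ P₂ h₂]
  refine sup_le_sup (inf_le_inf (inf_le_inf_left _ hle) (inf_le_inf_left _ hle))
    (le_inf (inf_le_left.trans (inf_le_inf_left _ hle)) ?_)
  calc P₁ ⊓ F ⊓ COL.oc (P₂ ⊓ F) ≤ COL.oc (P₂ ⊓ F) ⊓ F :=
        le_inf inf_le_right (inf_le_left.trans inf_le_right)
    _ ≤ COL.oc P₂ := (hF.1.1 P₂ h₂).symm.oc_inf_inf_le
    _ ≤ COL.oc (P₂ ⊓ sSup (COL.subcom A)) := COL.oc_antitone inf_le_left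
end
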